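/- arXiv:2409.14408 — 2 statements merged into one kernel-verified Lean document; each statement's English description precedes it below -/
import Mathlib

section
/- Let μ be a finite Borel measure on ℝ supported in (0, ∞) such that the function λ ↦ log λ is μ-integrable. Then the function t ↦ ∫ f(λ, t) dμ(λ) is integrable on (0, ∞) and ∫₀^∞ ( ∫ f(λ, t) dμ(λ) ) dt = ∫ log λ dμ(λ). -/
open MeasureTheory

/-- `f(λ, t) = −((t+1)⁻¹ − λ(t+λ)⁻¹)/t = (λ−1)/((t+1)(t+λ))`. -/
noncomputable def f (lam t : ℝ) : ℝ := (lam - 1) / ((t + 1) * (t + lam))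

theorem hasDerivAt_log_sub_log_f {lam t : ℝ} (hlam : 0 < lam) (ht : 0 ≤ t) :
    HasDerivAt (fun t => Real.log (t + 1) - Real.log (t + lam)) (f lam t) t := by
  have h1 : t + 1 ≠ 0 := by positivity
  have h2 : t + lam ≠ 0 := by positivity
  refine ((((hasDerivAt_id' t).add_const 1).log h1).sub
    (((hasDerivAt_id' t).add_const lam).log h2)).congr_deriv ?_
  rw [f]
  field_simp
  ring

theorem tendsto_log_add_one_sub_log_add (lam : ℝ) :
    Filter.Tendsto (fun t => Real.log (t + 1) - Real.log (t + lam)) Filter.atTop (nhds 0) := by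
  simpa using (Real.tendsto_log_comp_add_sub_log 1).sub (Real.tendsto_log_comp_add_sub_log lam)

theorem f_nonneg {lam t : ℝ} (hlam : 1 ≤ lam) (ht : 0 ≤ t) : 0 ≤ f lam t :=
  div_nonneg (by linarith) (mul_nonneg (by linarith) (by linarith))

theorem f_nonpos {lam t : ℝ} (hlam : 0 ≤ lam) (hlam' : lam ≤ 1) (ht : 0 ≤ t) : f lam t ≤ 0 :=
  div_nonpos_of_nonpos_of_nonneg (by linarith) (mul_nonneg (by linarith) (by linarith))

theorem integrableOn_f {lam : ℝ} (hlam : 0 < lam) : IntegrableOn (f lam) (Set.Ioi 0) := by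
  rcases le_total 1 lam with h | h
  · exact integrableOn_Ioi_deriv_of_nonneg' (fun t ht => hasDerivAt_log_sub_log_f hlam ht)
      (fun t ht => f_nonneg h (le_of_lt ht)) (tendsto_log_add_one_sub_log_add lam)
  · exact integrableOn_Ioi_deriv_of_nonpos' (fun t ht => hasDerivAt_log_sub_log_f hlam ht)
      (fun t ht => f_nonpos hlam.le h (le_of_lt ht)) (tendsto_log_add_one_sub_log_add lam)

theorem integral_f {lam : ℝ} (hlam : 0 < lam) : ∫ t in Set.Ioi 0, f lam t = Real.log lam := by
  simpa using integral_Ioi_of_hasDerivAt_of_tendsto'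
    (fun t ht => hasDerivAt_log_sub_log_f hlam ht) (integrableOn_f hlam)
    (tendsto_log_add_one_sub_log_add lam)

theorem integral_norm_f {lam : ℝ} (hlam : 0 < lam) :
    ∫ t in Set.Ioi 0, ‖f lam t‖ = ‖Real.log lam‖ := by
  rcases le_total 1 lam with h | h
  · rw [Real.norm_of_nonneg (Real.log_nonneg h), ← integral_f hlam]
    exact setIntegral_congr_fun measurableSet_Ioi
      fun t ht => Real.norm_of_nonneg (f_nonneg h (le_of_lt ht))
  · rw [Real.norm_of_nonpos (Real.log_nonpos hlam.le h), ← integral_f hlam, ← integral_neg]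
    exact setIntegral_congr_fun measurableSet_Ioi
      fun t ht => Real.norm_of_nonpos (f_nonpos hlam.le h (le_of_lt ht))

theorem measurable_uncurry_f : Measurable (Function.uncurry f) := by
  unfold f Function.uncurry
  fun_prop

theorem integrable_uncurry_f {μ : Measure ℝ} [SFinite μ] (hpos : ∀ᵐ lam ∂μ, 0 < lam)
    (hlog : Integrable Real.log μ) :
    Integrable (Function.uncurry f) (μ.prod (volume.restrict (Set.Ioi 0))) := by
  refine (integrable_prod_iff measurable_uncurry_f.aestronglyMeasurable).2 ⟨?_, ?_⟩
  · filter_upwards [hpos] with lam hlam using integrableOn_f hlam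
  · refine hlog.norm.congr ?_
    filter_upwards [hpos] with lam hlam using (integral_norm_f hlam).symm

/-- If `μ` is a finite Borel measure on `ℝ` supported in `(0, ∞)` with `log` μ-integrable,
then `t ↦ ∫ f(λ, t) dμ(λ)` is integrable on `(0, ∞)` and
`∫₀^∞ (∫ f(λ, t) dμ(λ)) dt = ∫ log λ dμ(λ)`. -/
theorem integral_integral_f_eq_integral_log (μ : Measure ℝ) [IsFiniteMeasure μ]
    (hsupp : μ (Set.Ioi (0 : ℝ))ᶜ = 0)
    (hlog : Integrable (fun lam => Real.log lam) μ) :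
    IntegrableOn (fun t => ∫ lam, f lam t ∂μ) (Set.Ioi (0 : ℝ)) volume ∧
      ∫ t in Set.Ioi (0 : ℝ), (∫ lam, f lam t ∂μ) = ∫ lam, Real.log lam ∂μ := by
  have hpos : ∀ᵐ lam ∂μ, 0 < lam := hsupp
  have hint := integrable_uncurry_f hpos hlog
  refine ⟨hint.integral_prod_right, ?_⟩
  rw [← integral_integral_swap hint]
  refine integral_congr_ae ?_
  filter_upwards [hpos] with lam hlam using integral_f hlam
end

section
/- Let μ be a finite Borel measure on ℝ supported in (0, ∞) such that λ ↦ λ^{t₀} is μ-integrable for some t₀ > 0, while the lower Lebesgue integral ∫ ENNReal.ofReal(max(−log λ, 0)) dμ(λ) is infinite. Then the difference quotient t ↦ ( ∫ λ^t dμ(λ) − μ(ℝ) ) / t tends to −∞ as t → 0⁺ (i.e., tends to the filter atBot along the filter of positive reals tending to 0). -/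
open MeasureTheory Filter

/-- Monotonicity in `t` of the difference quotient of `t ↦ x ^ t` at `0`, cleared of the
denominator `t`. -/
lemma Real.rpow_le_one_add_div_mul {x s t : ℝ} (hx : 0 < x) (ht : 0 < t) (hts : t ≤ s) :
    x ^ t ≤ 1 + t / s * (x ^ s - 1) := by
  have hs : 0 < s := ht.trans_le hts
  have h := Real.geom_mean_le_arith_mean2_weighted (w₁ := t / s) (w₂ := 1 - t / s)
    (p₁ := x ^ s) (p₂ := 1) (by positivity) (sub_nonneg.2 ((div_le_one hs).2 hts))
    (by positivity) zero_le_one (by ring)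
  rw [Real.one_rpow, mul_one, ← Real.rpow_mul hx.le, mul_div_cancel₀ _ hs.ne'] at h
  linarith

/-- The difference quotient of `t ↦ x ^ t` at `0` tends to `log x`. -/
lemma Real.tendsto_rpow_sub_one_div_nhdsGT {x : ℝ} (hx : 0 < x) :
    Tendsto (fun t : ℝ => (x ^ t - 1) / t) (nhdsWithin 0 (Set.Ioi 0)) (nhds (Real.log x)) := by
  have h := (Real.hasStrictDerivAt_const_rpow hx 0).hasDerivAt.tendsto_slope_zero_right
  simpa [div_eq_inv_mul] using h

/-- If `μ` is a finite Borel measure on `ℝ` supported in `(0, ∞)`, with `λ ↦ λ^t₀`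
μ-integrable for some `t₀ > 0` while `∫ (−log λ)⁺ dμ(λ) = ∞`, then
`(∫ λ^t dμ(λ) − μ(ℝ))/t → −∞` as `t → 0⁺`. -/
theorem tendsto_diffquot_integral_rpow_atBot (μ : Measure ℝ) [IsFiniteMeasure μ]
    (hsupp : μ (Set.Ioi (0 : ℝ))ᶜ = 0)
    (t₀ : ℝ) (ht₀ : 0 < t₀) (hpow : Integrable (fun lam => lam ^ t₀) μ)
    (hlog : ∫⁻ lam, ENNReal.ofReal (max (-Real.log lam) 0) ∂μ = ⊤) :
    Tendsto (fun t : ℝ => ((∫ lam, lam ^ t ∂μ) - (μ Set.univ).toReal) / t)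
      (nhdsWithin 0 (Set.Ioi 0)) atBot := by
  have hpos : ∀ᵐ x ∂μ, 0 < x := mem_ae_iff.2 hsupp
  have hsmall : ∀ᶠ t : ℝ in nhdsWithin 0 (Set.Ioi 0), 0 < t ∧ t ≤ t₀ :=
    Ioc_mem_nhdsGT ht₀
  -- The nonnegative functions to which Fatou's lemma is applied.
  let f : ℝ → ℝ → ℝ := fun t x => x ^ t₀ / t₀ - (x ^ t - 1) / t
  have hf_meas : ∀ t, Measurable (f t) := fun t => by fun_prop
  have hf_nonneg : ∀ t, 0 < t → t ≤ t₀ → 0 ≤ᵐ[μ] f t := by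
    intro t ht htt₀
    filter_upwards [hpos] with x hx
    have h := Real.rpow_le_one_add_div_mul hx ht htt₀
    have h' : (x ^ t - 1) / t ≤ (x ^ t₀ - 1) / t₀ := by
      rw [div_le_iff₀ ht]
      calc x ^ t - 1 ≤ t / t₀ * (x ^ t₀ - 1) := by linarith
        _ = (x ^ t₀ - 1) / t₀ * t := by ring
    have h'' : (x ^ t₀ - 1) / t₀ ≤ x ^ t₀ / t₀ := by gcongr; linarith
    exact sub_nonneg.2 (h'.trans h'')
  have hrpow_int : ∀ t, 0 < t → t ≤ t₀ → Integrable (fun x => x ^ t) μ := by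
    intro t ht htt₀
    refine ((integrable_const (1 : ℝ)).add ((hpow.sub (integrable_const 1)).const_mul
      (t / t₀))).mono' (by fun_prop) ?_
    filter_upwards [hpos] with x hx
    rw [Real.norm_of_nonneg (by positivity)]
    exact Real.rpow_le_one_add_div_mul hx ht htt₀
  have hf_int : ∀ t, 0 < t → t ≤ t₀ → Integrable (f t) μ := fun t ht htt₀ =>
    (hpow.div_const _).sub (((hrpow_int t ht htt₀).sub (integrable_const 1)).div_const _)
  have hfatou : Tendsto (fun t => ∫⁻ x, ENNReal.ofReal (f t x) ∂μ)
      (nhdsWithin 0 (Set.Ioi 0)) (nhds ⊤) := by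
    refine tendsto_of_le_liminf_of_limsup_le ?_ le_top
    rw [← hlog]
    refine le_trans (lintegral_mono_ae ?_)
      (lintegral_liminf_le fun t => (hf_meas t).ennreal_ofReal)
    filter_upwards [hpos] with x hx
    have hlim : Tendsto (fun t => ENNReal.ofReal (f t x)) (nhdsWithin 0 (Set.Ioi 0))
        (nhds (ENNReal.ofReal (x ^ t₀ / t₀ - Real.log x))) :=
      ENNReal.tendsto_ofReal
        (tendsto_const_nhds.sub (Real.tendsto_rpow_sub_one_div_nhdsGT hx))
    rw [hlim.liminf_eq]
    have h₁ : 0 ≤ x ^ t₀ / t₀ := by positivity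
    have h₂ := Real.log_le_rpow_div hx.le ht₀
    exact ENNReal.ofReal_le_ofReal (max_le (by linarith) (by linarith))
  have hf_top : Tendsto (fun t => ∫ x, f t x ∂μ) (nhdsWithin 0 (Set.Ioi 0)) atTop := by
    rw [← ENNReal.tendsto_ofReal_nhds_top]
    refine hfatou.congr' ?_
    filter_upwards [hsmall] with t ⟨ht, htt₀⟩
    exact (ofReal_integral_eq_lintegral_ofReal (hf_int t ht htt₀) (hf_nonneg t ht htt₀)).symm
  refine (tendsto_atBot_add_const_left _ (∫ x, x ^ t₀ / t₀ ∂μ)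
    (tendsto_neg_atTop_atBot.comp hf_top)).congr' ?_
  filter_upwards [hsmall] with t ⟨ht, htt₀⟩
  have hsub : Integrable (fun x => x ^ t - 1) μ :=
    (hrpow_int t ht htt₀).sub (integrable_const (1 : ℝ))
  have hf_eq : ∫ x, f t x ∂μ
      = ∫ x, x ^ t₀ / t₀ ∂μ - ((∫ x, x ^ t ∂μ) - (μ Set.univ).toReal) / t := by
    simp only [f]
    rw [integral_sub (hpow.div_const _) (hsub.div_const _), integral_div t,
      integral_sub (hrpow_int t ht htt₀) (integrable_const _)]
    simp [Measure.real]
  simp only [Function.comp_apply, hf_eq]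
  ring
end
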